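/- Let Σ be a finite alphabet with |Σ| ≥ 2 and let f_1,…,f_n : Σ^n → Σ be a coded chunk store of length n (i.e., with no redundancy: the joint map x ↦ (f_1(x),…,f_n(x)) is injective). Then every coordinate i ∈ {1,…,n} has a unique inclusion-minimal x_i-recovery set R_{x_i}; consequently, every subset X ⊆ {1,…,n} has a unique inclusion-minimal X-recovery set, namely R_X = ∪_{i∈X} R_{x_i}. -/

import Mathlib

/-- `R` is an `x i`-recovery set for the coded chunk store `f`: the values of the stored
chunks with positions in `R` determine `x i`. -/
def RecSet {n m : ℕ} {σ : Type*} (f : Fin m → (Fin n → σ) → σ) (R : Finset (Fin m))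
    (i : Fin n) : Prop :=
  ∀ x y : Fin n → σ, (∀ j ∈ R, f j x = f j y) → x i = y i

/-- `R` is an `X`-recovery set: it is an `x i`-recovery set for every `i ∈ X`. -/
def XRecSet {n m : ℕ} {σ : Type*} (f : Fin m → (Fin n → σ) → σ) (R : Finset (Fin m))
    (X : Finset (Fin n)) : Prop :=
  ∀ i ∈ X, RecSet f R i

/-- `R` is a minimal `X`-recovery set: it is an `X`-recovery set and no proper subset of it
is one. -/
def MinXRecSet {n m : ℕ} {σ : Type*} (f : Fin m → (Fin n → σ) → σ) (R : Finset (Fin m))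
    (X : Finset (Fin n)) : Prop :=
  XRecSet f R X ∧ ∀ R' ⊂ R, ¬ XRecSet f R' X

theorem XRecSet.mono' {n m : ℕ} {σ : Type*} {f : Fin m → (Fin n → σ) → σ}
    {R S : Finset (Fin m)} {X : Finset (Fin n)} (h : XRecSet f R X) (hs : R ⊆ S) :
    XRecSet f S X :=
  fun i hi x y hxy => h i hi x y fun j hj => hxy j (hs hj)

theorem XRecSet.inter' {n : ℕ} {σ : Type*} [Finite σ] {f : Fin n → (Fin n → σ) → σ}
    (hinj : Function.Injective (fun (x : Fin n → σ) (j : Fin n) => f j x))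
    {R S : Finset (Fin n)} {X : Finset (Fin n)} (hR : XRecSet f R X) (hS : XRecSet f S X) :
    XRecSet f (R ∩ S) X := by
  intro i hi x y hxy
  obtain ⟨z, hz⟩ := (Finite.injective_iff_surjective.mp hinj)
    (fun j => if j ∈ R then f j x else f j y)
  have hz' : ∀ j, f j z = if j ∈ R then f j x else f j y := fun j => congrFun hz j
  have h1 : x i = z i := hR i hi x z fun j hj => by rw [hz', if_pos hj]
  have h2 : z i = y i := hS i hi z y fun j hj => by
    rw [hz']
    split_ifs with hjR
    · exact hxy j (Finset.mem_inter.mpr ⟨hjR, hj⟩)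
    · rfl
  exact h1.trans h2

theorem MinXRecSet.subset' {n : ℕ} {σ : Type*} [Finite σ] {f : Fin n → (Fin n → σ) → σ}
    (hinj : Function.Injective (fun (x : Fin n → σ) (j : Fin n) => f j x))
    {R S : Finset (Fin n)} {X : Finset (Fin n)} (hR : MinXRecSet f R X) (hS : XRecSet f S X) :
    R ⊆ S := by
  by_contra hns
  refine hR.2 (R ∩ S) ⟨Finset.inter_subset_left, fun h => hns ?_⟩ (hR.1.inter' hinj hS)
  exact h.trans Finset.inter_subset_right

theorem existsUnique_minXRecSet {n : ℕ} {σ : Type*} [Finite σ] {f : Fin n → (Fin n → σ) → σ}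
    (hinj : Function.Injective (fun (x : Fin n → σ) (j : Fin n) => f j x))
    (X : Finset (Fin n)) : ∃! R : Finset (Fin n), MinXRecSet f R X := by
  have huniv : XRecSet f Finset.univ X := fun i _ x y hxy =>
    congrFun (hinj (funext fun j => hxy j (Finset.mem_univ j))) i
  obtain ⟨R, hR, hmin⟩ := (wellFounded_lt (α := Finset (Fin n))).has_min
    {R | XRecSet f R X} ⟨_, huniv⟩
  have hR' : MinXRecSet f R X := ⟨hR, fun R' hlt h => hmin R' h hlt⟩
  exact ⟨R, hR', fun S hS => (hS.subset' hinj hR).antisymm (hR'.subset' hinj hS.1)⟩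

/-- For a coded chunk store of length `n` with no redundancy (the joint map
is injective) over a finite alphabet with at least two symbols: every coordinate `i` has a
unique minimal `x i`-recovery set; consequently every `X ⊆ {1,…,n}` has a unique minimal
`X`-recovery set, namely the union of the minimal `x i`-recovery sets over `i ∈ X`. -/
theorem statement_7 {n : ℕ} (σ : Type*) [Fintype σ] (hσ : 2 ≤ Fintype.card σ)
    (f : Fin n → (Fin n → σ) → σ)
    (hinj : Function.Injective (fun (x : Fin n → σ) (j : Fin n) => f j x)) :
    (∀ i : Fin n, ∃! R : Finset (Fin n), MinXRecSet f R {i}) ∧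
    (∀ X : Finset (Fin n), ∃! R : Finset (Fin n), MinXRecSet f R X) ∧
    (∀ (X : Finset (Fin n)) (RX : Finset (Fin n)) (Ri : Fin n → Finset (Fin n)),
      MinXRecSet f RX X → (∀ i : Fin n, MinXRecSet f (Ri i) {i}) →
      RX = X.biUnion Ri) := by
  refine ⟨fun i => existsUnique_minXRecSet hinj {i}, existsUnique_minXRecSet hinj, ?_⟩
  intro X RX Ri hX hRi
  apply Finset.Subset.antisymm
  · refine hX.subset' hinj fun i hi => ?_
    exact (hRi i).1.mono' (Finset.subset_biUnion_of_mem Ri hi) i (Finset.mem_singleton_self i)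
  · refine Finset.biUnion_subset.mpr fun i hi => (hRi i).subset' hinj fun k hk => ?_
    rw [Finset.mem_singleton.mp hk]
    exact hX.1 i hi
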